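/- Let {I₁,…,I_s} be a partition of {1,…,m} into nonempty blocks and {J₁,…,J_t} a partition of {1,…,n} into nonempty blocks, with A_{I_i,:} ≠ 0 for all i and B_{:,J_j} ≠ 0 for all j. For each i let P_i be a Moore–Penrose pseudoinverse of A_{I_i,:}, and for each j let Q_j be a Moore–Penrose pseudoinverse of B_{:,J_j}. Let σ_A > 0 satisfy ‖A (Aᵀ u)‖₂ ≥ σ_A ‖Aᵀ u‖₂ for every u ∈ ℝ^m and σ_B > 0 satisfy ‖Bᵀ (B v)‖₂ ≥ σ_B ‖B v‖₂ for every v ∈ ℝ^n. Let β_A > 0 satisfy ‖A_{I_i,:} x‖₂ ≤ β_A ‖A_{I_i,:}‖_F ‖x‖₂ for all i and all x ∈ ℝ^p, and β_B > 0 satisfy ‖B_{:,J_j} c‖₂ ≤ β_B ‖B_{:,J_j}‖_F ‖c‖₂ for all j and all c ∈ ℝ^{|J_j|}. Let X ∈ ℝ^{p×q} satisfy X − X* = Aᵀ W Bᵀ for some W ∈ ℝ^{m×n}, and for each block pair (i,j) define the GRBK update X'_{(i,j)} = X + P_i (C_{I_i,J_j} − A_{I_i,:} X B_{:,J_j}) Q_j.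 Then ∑_{i=1}^s ∑_{j=1}^t (‖A_{I_i,:}‖_F² ‖B_{:,J_j}‖_F² / (‖A‖_F² ‖B‖_F²)) ‖X'_{(i,j)} − X*‖_F² ≤ (1 − σ_A² σ_B² / (‖A‖_F² β_A² ‖B‖_F² β_B²)) ‖X − X*‖_F². -/

import Mathlib

open Matrix

noncomputable def vecNormSq {α : Type*} [Fintype α] (x : α → ℝ) : ℝ := ∑ i, (x i) ^ 2

noncomputable def vecNorm {α : Type*} [Fintype α] (x : α → ℝ) : ℝ := Real.sqrt (vecNormSq x)

noncomputable def frobNormSq {α β : Type*} [Fintype α] [Fintype β] (M : Matrix α β ℝ) : ℝ :=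
  ∑ i, ∑ j, (M i j) ^ 2

noncomputable def frobNorm {α β : Type*} [Fintype α] [Fintype β] (M : Matrix α β ℝ) : ℝ :=
  Real.sqrt (frobNormSq M)

noncomputable def frobInner {α β : Type*} [Fintype α] [Fintype β] (U V : Matrix α β ℝ) : ℝ :=
  ∑ i, ∑ j, U i j * V i j

def IsMPInv {α β : Type*} [Fintype α] [Fintype β] (M : Matrix α β ℝ) (P : Matrix β α ℝ) : Prop :=
  M * P * M = M ∧ P * M * P = P ∧ (M * P)ᵀ = M * P ∧ (P * M)ᵀ = P * M

def rowSub {m p : ℕ} (A : Matrix (Fin m) (Fin p) ℝ) (I : Finset (Fin m)) :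
    Matrix {i // i ∈ I} (Fin p) ℝ := A.submatrix Subtype.val id

def colSub {q n : ℕ} (B : Matrix (Fin q) (Fin n) ℝ) (J : Finset (Fin n)) :
    Matrix (Fin q) {j // j ∈ J} ℝ := B.submatrix id Subtype.val

def subMat {m n : ℕ} (C : Matrix (Fin m) (Fin n) ℝ) (I : Finset (Fin m)) (J : Finset (Fin n)) :
    Matrix {i // i ∈ I} {j // j ∈ J} ℝ := C.submatrix Subtype.val Subtype.val

noncomputable def bilin {m p q n : ℕ} (A : Matrix (Fin m) (Fin p) ℝ) (B : Matrix (Fin q) (Fin n) ℝ)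
    (X : Matrix (Fin p) (Fin q) ℝ) (i : Fin m) (j : Fin n) : ℝ :=
  ∑ a, ∑ b, A i a * X a b * B b j

def rank1 {m p q n : ℕ} (A : Matrix (Fin m) (Fin p) ℝ) (B : Matrix (Fin q) (Fin n) ℝ)
    (i : Fin m) (j : Fin n) (s : ℝ) : Matrix (Fin p) (Fin q) ℝ :=
  Matrix.of fun a b => A i a * s * B b j

noncomputable def rowSubNorm {m p : ℕ} (A : Matrix (Fin m) (Fin p) ℝ) (I : Finset (Fin m)) :
    Matrix {i // i ∈ I} (Fin p) ℝ := Matrix.of fun i a => A i.val a / vecNorm (A i.val)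

noncomputable def colSubNorm {q n : ℕ} (B : Matrix (Fin q) (Fin n) ℝ) (J : Finset (Fin n)) :
    Matrix (Fin q) {j // j ∈ J} ℝ :=
  Matrix.of fun b j => B b j.val / vecNorm (fun b' => B b' j.val)

lemma grbk_vn_nonneg {α : Type*} [Fintype α] (x : α → ℝ) : 0 ≤ vecNormSq x :=
  Finset.sum_nonneg fun _ _ => sq_nonneg _

lemma grbk_vn_sq {α : Type*} [Fintype α] (x : α → ℝ) : vecNorm x ^ 2 = vecNormSq x :=
  Real.sq_sqrt (grbk_vn_nonneg x)

lemma grbk_fn_nonneg {α β : Type*} [Fintype α] [Fintype β] (M : Matrix α β ℝ) :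
    0 ≤ frobNormSq M :=
  Finset.sum_nonneg fun _ _ => Finset.sum_nonneg fun _ _ => sq_nonneg _

lemma grbk_fn_sq {α β : Type*} [Fintype α] [Fintype β] (M : Matrix α β ℝ) :
    frobNorm M ^ 2 = frobNormSq M :=
  Real.sq_sqrt (grbk_fn_nonneg M)

lemma grbk_fn_transpose {α β : Type*} [Fintype α] [Fintype β] (M : Matrix α β ℝ) :
    frobNormSq Mᵀ = frobNormSq M := by
  unfold frobNormSq
  rw [Finset.sum_comm]
  rfl

lemma grbk_fn_cols {α β : Type*} [Fintype α] [Fintype β] (M : Matrix α β ℝ) :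
    frobNormSq M = ∑ j, vecNormSq (fun i => M i j) := by
  unfold frobNormSq vecNormSq
  rw [Finset.sum_comm]

lemma grbk_fn_trace {α β : Type*} [Fintype α] [Fintype β] (M : Matrix α β ℝ) :
    frobNormSq M = trace (Mᵀ * M) := by
  rw [grbk_fn_cols]
  simp [trace, Matrix.mul_apply, vecNormSq, sq]

lemma grbk_mul_col {α β γ : Type*} [Fintype α] [Fintype β] [Fintype γ]
    (M : Matrix α β ℝ) (Y : Matrix β γ ℝ) (j : γ) :
    (fun i => (M * Y) i j) = M.mulVec (fun i => Y i j) := by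
  ext i
  simp [Matrix.mul_apply, Matrix.mulVec, dotProduct]

lemma grbk_vn_dot {α : Type*} [Fintype α] (x : α → ℝ) : vecNormSq x = x ⬝ᵥ x := by
  simp [vecNormSq, dotProduct, sq]

lemma grbk_fn_mul_le {α β γ : Type*} [Fintype α] [Fintype β] [Fintype γ]
    (M : Matrix α β ℝ) (Y : Matrix β γ ℝ) (k : ℝ)
    (h : ∀ x, vecNorm (M.mulVec x) ≤ k * vecNorm x) :
    frobNormSq (M * Y) ≤ k ^ 2 * frobNormSq Y := by
  rw [grbk_fn_cols, grbk_fn_cols, Finset.mul_sum]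
  refine Finset.sum_le_sum fun j _ => ?_
  rw [grbk_mul_col, ← grbk_vn_sq, ← grbk_vn_sq, ← mul_pow]
  exact pow_le_pow_left₀ (Real.sqrt_nonneg _) (h _) 2

lemma grbk_fn_mul_ge {α β γ : Type*} [Fintype α] [Fintype β] [Fintype γ]
    (M : Matrix α β ℝ) (Y : Matrix α γ ℝ) (k : ℝ) (hk : 0 ≤ k)
    (h : ∀ u, k * vecNorm (Mᵀ.mulVec u) ≤ vecNorm (M.mulVec (Mᵀ.mulVec u))) :
    k ^ 2 * frobNormSq (Mᵀ * Y) ≤ frobNormSq (M * (Mᵀ * Y)) := by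
  rw [grbk_fn_cols, grbk_fn_cols, Finset.mul_sum]
  refine Finset.sum_le_sum fun j _ => ?_
  rw [grbk_mul_col M, grbk_mul_col Mᵀ, ← grbk_vn_sq, ← grbk_vn_sq, ← mul_pow]
  exact pow_le_pow_left₀ (mul_nonneg hk (Real.sqrt_nonneg _)) (h _) 2

lemma grbk_transpose_bound {α β : Type*} [Fintype α] [Fintype β]
    (M : Matrix α β ℝ) (k : ℝ) (hk : 0 ≤ k)
    (h : ∀ x, vecNorm (M.mulVec x) ≤ k * vecNorm x) (y : α → ℝ) :
    vecNorm (Mᵀ.mulVec y) ≤ k * vecNorm y := by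
  have h0 : vecNorm (Mᵀ.mulVec y) ^ 2 = y ⬝ᵥ M.mulVec (Mᵀ.mulVec y) := by
    rw [grbk_vn_sq, grbk_vn_dot, dotProduct_mulVec, ← mulVec_transpose, transpose_transpose, dotProduct_comm]
  have hcs : y ⬝ᵥ M.mulVec (Mᵀ.mulVec y) ≤ vecNorm y * vecNorm (M.mulVec (Mᵀ.mulVec y)) := by
    unfold vecNorm vecNormSq
    exact Real.sum_mul_le_sqrt_mul_sqrt _ _ _
  have hy : 0 ≤ vecNorm y := Real.sqrt_nonneg _
  have hz : 0 ≤ vecNorm (Mᵀ.mulVec y) := Real.sqrt_nonneg _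
  have h1 := mul_le_mul_of_nonneg_left (h (Mᵀ.mulVec y)) hy
  rcases hz.eq_or_lt with hz | hz
  · rw [← hz]; positivity
  · refine le_of_mul_le_mul_right ?_ hz
    nlinarith

lemma grbk_pythag {α β : Type*} [Fintype α] [Fintype β] (E : Matrix α β ℝ)
    (S : Matrix α α ℝ) (T : Matrix β β ℝ) (hS : Sᵀ = S) (hT : Tᵀ = T)
    (hS2 : S * S = S) (hT2 : T * T = T) :
    frobNormSq (E - S * E * T) = frobNormSq E - frobNormSq (S * E * T) := by
  have e1 : trace (Eᵀ * (S * E * T)) = trace (T * (Eᵀ * (S * (E * T)))) := by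
    have : Eᵀ * (S * E * T) = (Eᵀ * (S * (E * T))) * T := by
      simp only [Matrix.mul_assoc, hT2]
    rw [this, trace_mul_comm]
  have e2 : trace ((S * E * T)ᵀ * E) = trace (T * (Eᵀ * (S * (E * T)))) := by
    have h2 : (S * E * T)ᵀ * E = T * (T * (Eᵀ * (S * E))) := by
      simp only [transpose_mul, hS, hT, ← Matrix.mul_assoc, hT2]
    rw [h2, trace_mul_comm]
    simp only [Matrix.mul_assoc]
  have e3 : trace ((S * E * T)ᵀ * (S * E * T)) = trace (T * (Eᵀ * (S * (E * T)))) := by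
    congr 1
    simp only [transpose_mul, hS, hT, Matrix.mul_assoc]
    rw [← Matrix.mul_assoc S S, hS2]
  rw [grbk_fn_trace, grbk_fn_trace, grbk_fn_trace, transpose_sub, Matrix.sub_mul, Matrix.mul_sub,
    Matrix.mul_sub, trace_sub, trace_sub, trace_sub, e1, e2, e3]
  ring

lemma grbk_part {m s : ℕ} (I : Fin s → Finset (Fin m)) (h : ∀ i, ∃! a, i ∈ I a)
    (f : Fin m → ℝ) : ∑ a, ∑ i : {i // i ∈ I a}, f i = ∑ i, f i := by
  have : ∀ a, ∑ i : {i // i ∈ I a}, f i = ∑ i, if i ∈ I a then f i else 0 := by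
    intro a
    rw [← Finset.sum_filter, Finset.filter_univ_mem]
    exact Finset.sum_coe_sort (I a) f
  simp only [this]
  rw [Finset.sum_comm]
  refine Finset.sum_congr rfl fun i _ => ?_
  obtain ⟨a, ha, hu⟩ := h i
  rw [Finset.sum_eq_single a]
  · simp only [ha, if_true]
  · intro b _ hb
    exact if_neg fun hh => hb (hu b hh)
  · simp

lemma grbk_sum_sub {m n s t : ℕ} (D : Matrix (Fin m) (Fin n) ℝ)
    (I : Fin s → Finset (Fin m)) (J : Fin t → Finset (Fin n))
    (hI : ∀ i, ∃! a, i ∈ I a) (hJ : ∀ i, ∃! a, i ∈ J a) :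
    ∑ a, ∑ b, frobNormSq (subMat D (I a) (J b)) = frobNormSq D := by
  unfold frobNormSq
  rw [← grbk_part I hI]
  refine Finset.sum_congr rfl fun a _ => ?_
  rw [Finset.sum_comm]
  refine Finset.sum_congr rfl fun i _ => ?_
  exact grbk_part J hJ (fun j => D i j ^ 2)

lemma grbk_sum_row {m p s : ℕ} (D : Matrix (Fin m) (Fin p) ℝ)
    (I : Fin s → Finset (Fin m)) (hI : ∀ i, ∃! a, i ∈ I a) :
    ∑ a, frobNormSq (rowSub D (I a)) = frobNormSq D :=
  grbk_part I hI (fun i => ∑ j, D i j ^ 2)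

lemma grbk_sum_col {m p s : ℕ} (D : Matrix (Fin p) (Fin m) ℝ)
    (I : Fin s → Finset (Fin m)) (hI : ∀ i, ∃! a, i ∈ I a) :
    ∑ a, frobNormSq (colSub D (I a)) = frobNormSq D := by
  rw [← grbk_fn_transpose D, ← grbk_sum_row Dᵀ I hI]
  refine Finset.sum_congr rfl fun a _ => ?_
  rw [← grbk_fn_transpose]
  rfl

lemma grbk_block {α β γ δ : Type*} [Fintype α] [Fintype β] [Fintype γ] [Fintype δ]
    (M : Matrix α β ℝ) (N : Matrix γ δ ℝ) (P : Matrix β α ℝ) (Q : Matrix δ γ ℝ)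
    (hP : IsMPInv M P) (hQ : IsMPInv N Q) (k l : ℝ) (hl : 0 ≤ l)
    (hM : ∀ x, vecNorm (M.mulVec x) ≤ k * vecNorm x)
    (hN : ∀ x, vecNorm (N.mulVec x) ≤ l * vecNorm x) (E : Matrix β γ ℝ) :
    frobNormSq (M * E * N) ≤
      k ^ 2 * l ^ 2 * (frobNormSq E - frobNormSq (E - P * (M * E * N) * Q)) := by
  obtain ⟨p1, p2, p3, p4⟩ := hP
  obtain ⟨q1, q2, q3, q4⟩ := hQ
  have e : P * (M * E * N) * Q = (P * M) * E * (N * Q) := by simp only [Matrix.mul_assoc]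
  rw [e, grbk_pythag E (P * M) (N * Q) p4 q3 (by rw [← Matrix.mul_assoc, p2])
    (by rw [← Matrix.mul_assoc, q1]), sub_sub_cancel]
  set Y := P * M * E * (N * Q) with hY
  have e2 : M * E * N = M * (Y * N) := by
    calc M * E * N = (M * P * M) * E * (N * Q * N) := by rw [p1, q1]
      _ = M * (Y * N) := by rw [hY]; simp only [Matrix.mul_assoc]
  rw [e2]
  have h1 := grbk_fn_mul_le M (Y * N) k hM
  have h2 : frobNormSq (Y * N) ≤ l ^ 2 * frobNormSq Y := by
    rw [← grbk_fn_transpose (Y * N), transpose_mul, ← grbk_fn_transpose Y]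
    exact grbk_fn_mul_le _ _ _ (grbk_transpose_bound N l hl hN)
  have h3 := mul_le_mul_of_nonneg_left h2 (sq_nonneg k)
  linarith

/-- one-step expected squared error bound for the GRBK method with
partition sampling. -/
theorem grbk_one_step_expected_error {m p q n s t : ℕ}
    (A : Matrix (Fin m) (Fin p) ℝ) (B : Matrix (Fin q) (Fin n) ℝ)
    (Xs : Matrix (Fin p) (Fin q) ℝ) (C : Matrix (Fin m) (Fin n) ℝ) (hC : C = A * Xs * B)
    (Ib : Fin s → Finset (Fin m)) (Jb : Fin t → Finset (Fin n))
    (hIne : ∀ a, (Ib a).Nonempty) (hJne : ∀ b, (Jb b).Nonempty)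
    (hIpart : ∀ i : Fin m, ∃! a, i ∈ Ib a) (hJpart : ∀ j : Fin n, ∃! b, j ∈ Jb b)
    (hAnz : ∀ a, rowSub A (Ib a) ≠ 0) (hBnz : ∀ b, colSub B (Jb b) ≠ 0)
    (P : ∀ a, Matrix (Fin p) {i // i ∈ Ib a} ℝ)
    (hP : ∀ a, IsMPInv (rowSub A (Ib a)) (P a))
    (Q : ∀ b, Matrix {j // j ∈ Jb b} (Fin q) ℝ)
    (hQ : ∀ b, IsMPInv (colSub B (Jb b)) (Q b))
    (σA σB βA βB : ℝ) (hσA : 0 < σA) (hσB : 0 < σB) (hβA : 0 < βA) (hβB : 0 < βB)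
    (hA : ∀ u : Fin m → ℝ, σA * vecNorm (Aᵀ.mulVec u) ≤ vecNorm (A.mulVec (Aᵀ.mulVec u)))
    (hB : ∀ v : Fin n → ℝ, σB * vecNorm (B.mulVec v) ≤ vecNorm (Bᵀ.mulVec (B.mulVec v)))
    (hβA2 : ∀ a, ∀ x : Fin p → ℝ,
      vecNorm ((rowSub A (Ib a)).mulVec x) ≤ βA * frobNorm (rowSub A (Ib a)) * vecNorm x)
    (hβB2 : ∀ b, ∀ c : {j // j ∈ Jb b} → ℝ,
      vecNorm ((colSub B (Jb b)).mulVec c) ≤ βB * frobNorm (colSub B (Jb b)) * vecNorm c)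
    (X : Matrix (Fin p) (Fin q) ℝ) (W : Matrix (Fin m) (Fin n) ℝ)
    (hX : X - Xs = Aᵀ * W * Bᵀ) :
    ∑ a, ∑ b,
        (frobNormSq (rowSub A (Ib a)) * frobNormSq (colSub B (Jb b)) /
            (frobNormSq A * frobNormSq B)) *
          frobNormSq ((X + P a *
            (subMat C (Ib a) (Jb b) - rowSub A (Ib a) * X * colSub B (Jb b)) * Q b) - Xs)
      ≤ (1 - σA ^ 2 * σB ^ 2 / (frobNormSq A * βA ^ 2 * frobNormSq B * βB ^ 2)) *
          frobNormSq (X - Xs) := by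
  set E := X - Xs with hE
  set fA := frobNormSq A
  set fB := frobNormSq B
  have hup : ∀ a b, (X + P a *
      (subMat C (Ib a) (Jb b) - rowSub A (Ib a) * X * colSub B (Jb b)) * Q b) - Xs
      = E - P a * (rowSub A (Ib a) * E * colSub B (Jb b)) * Q b := by
    intro a b
    have hs : subMat C (Ib a) (Jb b) = rowSub A (Ib a) * Xs * colSub B (Jb b) := by
      rw [hC]; rfl
    rw [hs, hE]
    simp only [Matrix.mul_sub, Matrix.sub_mul]
    abel
  simp only [hup]
  have hfA : 0 ≤ fA := grbk_fn_nonneg A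
  have hfB : 0 ≤ fB := grbk_fn_nonneg B
  rcases hfA.eq_or_lt with h0 | hApos
  · simp [← h0, grbk_fn_nonneg]
  rcases hfB.eq_or_lt with h0 | hBpos
  · simp [← h0, grbk_fn_nonneg]
  have hterm : ∀ a b, frobNormSq (rowSub A (Ib a)) * frobNormSq (colSub B (Jb b)) / (fA * fB) *
      frobNormSq (E - P a * (rowSub A (Ib a) * E * colSub B (Jb b)) * Q b) ≤
      frobNormSq (rowSub A (Ib a)) * frobNormSq (colSub B (Jb b)) * (frobNormSq E / (fA * fB)) -
      frobNormSq (subMat (A * E * B) (Ib a) (Jb b)) * (1 / (fA * βA ^ 2 * fB * βB ^ 2)) := by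
    intro a b
    have h := grbk_block _ _ _ _ (hP a) (hQ b) (βA * frobNorm (rowSub A (Ib a)))
      (βB * frobNorm (colSub B (Jb b))) (mul_nonneg hβB.le (Real.sqrt_nonneg _))
      (hβA2 a) (hβB2 b) E
    have hs : subMat (A * E * B) (Ib a) (Jb b) = rowSub A (Ib a) * E * colSub B (Jb b) := rfl
    rw [hs]
    rw [mul_pow, mul_pow, grbk_fn_sq, grbk_fn_sq] at h
    generalize frobNormSq (E - P a * (rowSub A (Ib a) * E * colSub B (Jb b)) * Q b) = e' at *
    generalize frobNormSq (rowSub A (Ib a) * E * colSub B (Jb b)) = r at *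
    have h2 := mul_le_mul_of_nonneg_right h
      (show 0 ≤ 1 / (fA * βA ^ 2 * fB * βB ^ 2) by positivity)
    refine (le_sub_comm.mp (h2.trans (le_of_eq ?_)))
    field_simp
  refine (Finset.sum_le_sum fun a _ => Finset.sum_le_sum fun b _ => hterm a b).trans ?_
  simp only [Finset.sum_sub_distrib, ← Finset.sum_mul, ← Finset.mul_sum]
  rw [grbk_sum_sub _ _ _ hIpart hJpart, grbk_sum_row _ _ hIpart, grbk_sum_col _ _ hJpart]
  have hlow : σA ^ 2 * σB ^ 2 * frobNormSq E ≤ frobNormSq (A * E * B) := by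
    have h1 := grbk_fn_mul_ge A (W * Bᵀ * B) σA hσA.le hA
    have h2 := grbk_fn_mul_ge Bᵀ (Wᵀ * A) σB hσB.le (by simpa using hB)
    have e1 : A * (Aᵀ * (W * Bᵀ * B)) = A * E * B := by
      rw [hX]; simp only [Matrix.mul_assoc]
    have e2 : Bᵀ * (Bᵀᵀ * (Wᵀ * A)) = (Aᵀ * (W * Bᵀ * B))ᵀ := by
      simp [transpose_mul, Matrix.mul_assoc]
    have e3 : Bᵀᵀ * (Wᵀ * A) = Eᵀ := by
      rw [hX]; simp [transpose_mul, Matrix.mul_assoc]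
    rw [e2, e3, grbk_fn_transpose, grbk_fn_transpose] at h2
    rw [e1] at h1
    have h3 := mul_le_mul_of_nonneg_left h2 (sq_nonneg σA)
    linarith
  have h4 := mul_le_mul_of_nonneg_right hlow
    (show 0 ≤ 1 / (fA * βA ^ 2 * fB * βB ^ 2) by positivity)
  have e5 : fA * fB * (frobNormSq E / (fA * fB)) = frobNormSq E := by field_simp
  have e6 : (1 - σA ^ 2 * σB ^ 2 / (fA * βA ^ 2 * fB * βB ^ 2)) * frobNormSq E =
    frobNormSq E - σA ^ 2 * σB ^ 2 * frobNormSq E * (1 / (fA * βA ^ 2 * fB * βB ^ 2)) := by ring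
  rw [e6]
  change fA * fB * _ - _ ≤ _
  rw [e5]
  linarith
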